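/- Let H be an M×K complex matrix with HᴴH invertible, u ∈ ℂ^K, γ > 0, b = √γ · H(HᴴH)⁻¹u, and for δ > 0 let x_δ = (HHᴴ + δ I_M)⁻¹ HHᴴ b. Then Hᴴ x_δ − √γ u = −√γ · δ · (HᴴH + δ I_K)⁻¹ u, and consequently the residual distortion satisfies ‖Hᴴ x_δ − √γ u‖² = γ δ² · uᴴ (HᴴH + δ I_K)⁻² u. -/

import Mathlib

open Matrix

/-- Squared Euclidean (ℓ²) norm of a complex vector. -/
noncomputable def sqNorm {n : ℕ} (v : Fin n → ℂ) : ℝ := ∑ i, ‖v i‖ ^ 2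

/-- The zero-forcing vector `b = √γ · H (Hᴴ H)⁻¹ u`. -/
noncomputable def bVec {M K : ℕ} (H : Matrix (Fin M) (Fin K) ℂ) (u : Fin K → ℂ) (γ : ℝ) :
    Fin M → ℂ :=
  ((Real.sqrt γ : ℂ)) • (H * (Hᴴ * H)⁻¹).mulVec u

/-- The regularized zero-forcing vector `x_δ = (H Hᴴ + δ I)⁻¹ (H Hᴴ) b`. -/
noncomputable def xVec {M K : ℕ} (H : Matrix (Fin M) (Fin K) ℂ) (u : Fin K → ℂ) (γ δ : ℝ) :
    Fin M → ℂ :=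
  (((H * Hᴴ + (δ : ℂ) • (1 : Matrix (Fin M) (Fin M) ℂ))⁻¹) * (H * Hᴴ)).mulVec (bVec H u γ)

open scoped ComplexOrder in
/-- A Gram matrix shifted by a positive multiple of the identity is positive definite. -/
theorem posDef_conjTranspose_mul_self_add_smul_one {m n : Type*} [Fintype m] [Fintype n]
    [DecidableEq n] (A : Matrix m n ℂ) {δ : ℝ} (hδ : 0 < δ) :
    (Aᴴ * A + (δ : ℂ) • (1 : Matrix n n ℂ)).PosDef :=
  (PosDef.one.smul (by exact_mod_cast hδ : (0 : ℂ) < δ)).posSemidef_add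
    (posSemidef_conjTranspose_mul_self A)

open scoped ComplexOrder in
theorem isUnit_det_conjTranspose_mul_self_add_smul_one {m n : Type*} [Fintype m] [Fintype n]
    [DecidableEq n] (A : Matrix m n ℂ) {δ : ℝ} (hδ : 0 < δ) :
    IsUnit (Aᴴ * A + (δ : ℂ) • (1 : Matrix n n ℂ)).det :=
  (isUnit_iff_isUnit_det _).1 (posDef_conjTranspose_mul_self_add_smul_one A hδ).isUnit

open scoped ComplexOrder in
theorem isHermitian_inv_conjTranspose_mul_self_add_smul_one {m n : Type*} [Fintype m] [Fintype n]
    [DecidableEq n] (A : Matrix m n ℂ) {δ : ℝ} (hδ : 0 < δ) :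
    (Aᴴ * A + (δ : ℂ) • (1 : Matrix n n ℂ))⁻¹.IsHermitian :=
  (posDef_conjTranspose_mul_self_add_smul_one A hδ).isHermitian.inv

/-- The push-through identity for regularized inverses. -/
theorem conjTranspose_mul_inv_add_smul_one {m n : Type*} [Fintype m] [Fintype n]
    [DecidableEq m] [DecidableEq n] (A : Matrix m n ℂ) {δ : ℝ} (hδ : 0 < δ) :
    Aᴴ * (A * Aᴴ + (δ : ℂ) • (1 : Matrix m m ℂ))⁻¹ =
      (Aᴴ * A + (δ : ℂ) • (1 : Matrix n n ℂ))⁻¹ * Aᴴ := by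
  have hP := isUnit_det_conjTranspose_mul_self_add_smul_one A hδ
  have hQ := isUnit_det_conjTranspose_mul_self_add_smul_one Aᴴ hδ
  rw [conjTranspose_conjTranspose] at hQ
  have hcomm : (Aᴴ * A + (δ : ℂ) • (1 : Matrix n n ℂ)) * Aᴴ =
      Aᴴ * (A * Aᴴ + (δ : ℂ) • (1 : Matrix m m ℂ)) := by
    simp [Matrix.add_mul, Matrix.mul_add, Matrix.mul_assoc]
  rw [← nonsing_inv_mul_cancel_left _ (Aᴴ * _) hP, ← Matrix.mul_assoc _ Aᴴ, hcomm,
    mul_nonsing_inv_cancel_right _ _ hQ]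

theorem sqNorm_eq_star_dotProduct {n : ℕ} (v : Fin n → ℂ) : (sqNorm v : ℂ) = star v ⬝ᵥ v := by
  simp [sqNorm, dotProduct, Complex.conj_mul']

/-- The regularized zero-forcing map differs from the identity by `-δ (Hᴴ H + δ I)⁻¹`. -/
theorem conjTranspose_mulVec_xVec {M K : ℕ} (H : Matrix (Fin M) (Fin K) ℂ)
    (hH : IsUnit (Hᴴ * H)) (u : Fin K → ℂ) (γ : ℝ) {δ : ℝ} (hδ : 0 < δ) :
    Hᴴ.mulVec (xVec H u γ δ) - (Real.sqrt γ : ℂ) • u =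
      (-((Real.sqrt γ : ℂ) * (δ : ℂ))) •
        ((Hᴴ * H + (δ : ℂ) • (1 : Matrix (Fin K) (Fin K) ℂ))⁻¹).mulVec u := by
  have hP := isUnit_det_conjTranspose_mul_self_add_smul_one H hδ
  have hA := (isUnit_iff_isUnit_det _).1 hH
  have hpush := conjTranspose_mul_inv_add_smul_one H hδ
  set P := Hᴴ * H + (δ : ℂ) • (1 : Matrix (Fin K) (Fin K) ℂ) with hPdef
  have hmat : Hᴴ * ((H * Hᴴ + (δ : ℂ) • (1 : Matrix (Fin M) (Fin M) ℂ))⁻¹ * (H * Hᴴ)) *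
      (H * (Hᴴ * H)⁻¹) = 1 - (δ : ℂ) • P⁻¹ := by
    calc _ = P⁻¹ * (Hᴴ * H) * ((Hᴴ * H) * (Hᴴ * H)⁻¹) := by
          rw [← Matrix.mul_assoc Hᴴ, hpush]
          simp only [Matrix.mul_assoc]
      _ = P⁻¹ * (P - (δ : ℂ) • 1) := by
          rw [mul_nonsing_inv _ hA, Matrix.mul_one, hPdef, add_sub_cancel_right]
      _ = 1 - (δ : ℂ) • P⁻¹ := by
          rw [Matrix.mul_sub, nonsing_inv_mul _ hP, Matrix.mul_smul, Matrix.mul_one]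
  rw [xVec, bVec, mulVec_smul, mulVec_smul, mulVec_mulVec, mulVec_mulVec,
    hmat, sub_mulVec, one_mulVec, smul_mulVec, smul_sub, smul_smul, neg_smul]
  abel

/-- `Hᴴ x_δ − √γ u = −√γ δ (Hᴴ H + δ I)⁻¹ u` and the residual distortion is
`‖Hᴴ x_δ − √γ u‖² = γ δ² uᴴ (Hᴴ H + δ I)⁻² u`. -/
theorem stmt3 {M K : ℕ} (hM : 0 < M) (hK : 0 < K)
    (H : Matrix (Fin M) (Fin K) ℂ) (hH : IsUnit (Hᴴ * H))
    (u : Fin K → ℂ) (γ : ℝ) (hγ : 0 < γ) (δ : ℝ) (hδ : 0 < δ) :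
    Hᴴ.mulVec (xVec H u γ δ) - (Real.sqrt γ : ℂ) • u =
      (-((Real.sqrt γ : ℂ) * (δ : ℂ))) •
        ((Hᴴ * H + (δ : ℂ) • (1 : Matrix (Fin K) (Fin K) ℂ))⁻¹).mulVec u ∧
    (sqNorm (Hᴴ.mulVec (xVec H u γ δ) - (Real.sqrt γ : ℂ) • u) : ℂ) =
      (γ : ℂ) * (δ : ℂ) ^ 2 *
        (star u ⬝ᵥ
          ((Hᴴ * H + (δ : ℂ) • (1 : Matrix (Fin K) (Fin K) ℂ))⁻¹ *
            (Hᴴ * H + (δ : ℂ) • (1 : Matrix (Fin K) (Fin K) ℂ))⁻¹).mulVec u) := by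
  have hres := conjTranspose_mulVec_xVec H hH u γ hδ
  refine ⟨hres, ?_⟩
  have hherm := isHermitian_inv_conjTranspose_mul_self_add_smul_one H hδ
  rw [hres, sqNorm_eq_star_dotProduct]
  set R := (Hᴴ * H + (δ : ℂ) • (1 : Matrix (Fin K) (Fin K) ℂ))⁻¹
  have hγ' : (Real.sqrt γ : ℂ) * Real.sqrt γ = γ := by
    exact_mod_cast Real.mul_self_sqrt hγ.le
  have hquad : star (R *ᵥ u) ⬝ᵥ (R *ᵥ u) = star u ⬝ᵥ ((R * R) *ᵥ u) := by
    rw [star_mulVec, hherm.eq, ← dotProduct_mulVec, mulVec_mulVec]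
  rw [star_smul, smul_dotProduct, dotProduct_smul, hquad, ← hγ']
  simp only [star_neg, star_mul', Complex.star_def, Complex.conj_ofReal, smul_eq_mul]
  ring
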